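/- Let r > 0, let C ⊂ ℝ^d be a bounded r-prox-regular set, and let θ ∈ P₂(ℝ^d) satisfy supp θ ⊂ C + r·B°, where B° is the open unit ball. Let θ_C = (P_C)♯θ be the projection of θ on C. Then θ and θ_C are connected by a unique constant-speed minimal geodesic in (P₂(ℝ^d), W₂), and this geodesic is given by ρ_t = ((1−t)·id + t·P_C)♯θ for t ∈ [0,1]. -/

import Mathlib

open MeasureTheory Filter Metric Set
open scoped Topology ENNReal NNReal RealInnerProductSpace

noncomputable section

abbrev Rd (d : ℕ) := EuclideanSpace ℝ (Fin d)

namespace MSP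

variable {d : ℕ}

/-- The topological support of a measure. -/
def msupport {α : Type*} [TopologicalSpace α] {mα : MeasurableSpace α} (μ : Measure α) :
    Set α :=
  {x | ∀ U : Set α, IsOpen U → x ∈ U → 0 < μ U}

/-- `π` is a transport plan (coupling) between `μ` and `ν`. -/
def IsCoupling (π : Measure (Rd d × Rd d)) (μ ν : Measure (Rd d)) : Prop :=
  π.map Prod.fst = μ ∧ π.map Prod.snd = ν

/-- The quadratic transport cost of a plan. -/
def cost2 (π : Measure (Rd d × Rd d)) : ℝ≥0∞ :=
  ∫⁻ p, (‖p.1 - p.2‖₊ : ℝ≥0∞) ^ 2 ∂π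

/-- The squared quadratic Wasserstein distance (as an extended real). -/
def W2sq (μ ν : Measure (Rd d)) : ℝ≥0∞ :=
  sInf {c | ∃ π : Measure (Rd d × Rd d), IsCoupling π μ ν ∧ c = cost2 π}

/-- The quadratic Wasserstein distance. -/
def W2 (μ ν : Measure (Rd d)) : ℝ :=
  Real.sqrt (W2sq μ ν).toReal

/-- An optimal transport plan for the quadratic cost. -/
def IsOptimalPlan (π : Measure (Rd d × Rd d)) (μ ν : Measure (Rd d)) : Prop :=
  IsCoupling π μ ν ∧ cost2 π = W2sq μ ν

def HasFiniteSecondMoment (μ : Measure (Rd d)) : Prop :=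
  ∫⁻ x, (‖x‖₊ : ℝ≥0∞) ^ 2 ∂μ < ⊤

/-- `μ` belongs to the Wasserstein space `P₂(ℝ^d)`. -/
def IsP2 (μ : Measure (Rd d)) : Prop :=
  IsProbabilityMeasure μ ∧ HasFiniteSecondMoment μ

/-- The set of nearest points of `S` to `x` (metric projection set). -/
def projSet {E : Type*} [MetricSpace E] (S : Set E) (x : E) : Set E :=
  {a | a ∈ S ∧ dist x a = infDist x S}

/-- `S` is `r`-prox-regular: the metric projection onto `S` is single-valued and
continuous on the open `r`-neighborhood of `S`. -/
def IsProxRegular {E : Type*} [MetricSpace E] (r : ℝ) (S : Set E) : Prop :=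
  IsClosed S ∧ ∃ P : E → E,
    (∀ x, infDist x S < r → projSet S x = {P x}) ∧
    ContinuousOn P {x | infDist x S < r}

/-- The proximal normal cone to `S` at `x`. -/
def proxNormalCone {E : Type*} [NormedAddCommGroup E] [InnerProductSpace ℝ E]
    (S : Set E) (x : E) : Set E :=
  {v | ∃ σ : ℝ, 0 ≤ σ ∧ ∀ y ∈ S, ⟪v, y - x⟫ ≤ σ * ‖y - x‖ ^ 2}

/-- Assumption (A₁) on the nonlocal vector field `𝒱`. -/
def A1 (L : ℝ) (V : Measure (Rd d) → Rd d → Rd d) : Prop :=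
  (∀ μ ν : Measure (Rd d), IsP2 μ → IsP2 ν → ∀ x, ‖V μ x - V ν x‖ ≤ L * W2 μ ν) ∧
  (∀ μ : Measure (Rd d), IsP2 μ → ∀ x y, ‖V μ x - V μ y‖ ≤ L * ‖x - y‖) ∧
  (∀ μ : Measure (Rd d), IsP2 μ → ∀ x, ‖V μ x‖ ≤ L) ∧
  (∀ μ : Measure (Rd d), IsP2 μ → Continuous (V μ))

/-- Assumption (A₂) on the moving viability set `𝐂`. -/
def A2 (T M r : ℝ) (C : ℝ → Set (Rd d)) : Prop :=
  (∀ s ∈ Icc (0:ℝ) T, ∀ t ∈ Icc (0:ℝ) T, hausdorffDist (C s) (C t) ≤ M * |s - t|) ∧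
  ∀ t ∈ Icc (0:ℝ) T, IsCompact (C t) ∧ (C t).Nonempty ∧ IsProxRegular r (C t)

/-- `(ρ, v)` solves the continuity equation `∂ₜρ + ∇·(vρ) = 0` on `(0,T)×ℝ^d` in
the sense of distributions. -/
def IsContEqSol (T : ℝ) (ρ : ℝ → Measure (Rd d)) (v : ℝ → Rd d → Rd d) : Prop :=
  ∀ φ : ℝ → Rd d → ℝ,
    ContDiff ℝ ((⊤ : ℕ∞) : WithTop ℕ∞) (fun p : ℝ × Rd d => φ p.1 p.2) →
    HasCompactSupport (fun p : ℝ × Rd d => φ p.1 p.2) →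
    tsupport (fun p : ℝ × Rd d => φ p.1 p.2) ⊆ Ioo (0:ℝ) T ×ˢ (univ : Set (Rd d)) →
    ∫ t in Ioo (0:ℝ) T,
      ∫ x, (deriv (fun s => φ s x) t + ⟪v t x, gradient (φ t) x⟫) ∂(ρ t) = 0

/-- `ρ` is an absolutely continuous curve in `P₂(ℝ^d)` on `[0,T]`. -/
def IsAbsCont (T : ℝ) (ρ : ℝ → Measure (Rd d)) : Prop :=
  ∃ g : ℝ → ℝ, IntegrableOn g (Icc (0:ℝ) T) ∧
    ∀ s t : ℝ, 0 ≤ s → s ≤ t → t ≤ T → W2 (ρ s) (ρ t) ≤ ∫ τ in Ioc s t, g τ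

/-- `ρ` (with Borel velocity field `v`) is a solution of the measure sweeping
process driven by `𝐂` with perturbation `𝒱`. -/
def IsMSPSol (T : ℝ) (V : Measure (Rd d) → Rd d → Rd d) (C : ℝ → Set (Rd d))
    (ρ : ℝ → Measure (Rd d)) (v : ℝ → Rd d → Rd d) : Prop :=
  (∀ t ∈ Icc (0:ℝ) T, IsP2 (ρ t)) ∧
  IsAbsCont T ρ ∧
  Measurable (fun p : ℝ × Rd d => v p.1 p.2) ∧
  IsContEqSol T ρ v ∧
  (∀ᵐ t ∂(volume.restrict (Icc (0:ℝ) T)),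
    ∀ᵐ x ∂(ρ t), V (ρ t) x - v t x ∈ proxNormalCone (C t) x) ∧
  ∀ t ∈ Icc (0:ℝ) T, msupport (ρ t) ⊆ C t

/-- The graph of the set-valued map `𝐂`, as a subset of the euclidean product
`ℝ ×₂ ℝ^d`. -/
def graphSet (T : ℝ) (C : ℝ → Set (Rd d)) : Set (WithLp 2 (ℝ × Rd d)) :=
  {p | (WithLp.equiv 2 (ℝ × Rd d) p).1 ∈ Icc (0:ℝ) T ∧
       (WithLp.equiv 2 (ℝ × Rd d) p).2 ∈ C ((WithLp.equiv 2 (ℝ × Rd d) p).1)}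

/-- Continuity of a curve of measures with respect to `W₂`, on `[0,T]`. -/
def W2ContinuousOn (T : ℝ) (ρ : ℝ → Measure (Rd d)) : Prop :=
  ∀ t₀ ∈ Icc (0:ℝ) T, ∀ ε > (0:ℝ), ∃ δ > (0:ℝ),
    ∀ t ∈ Icc (0:ℝ) T, |t - t₀| < δ → W2 (ρ t) (ρ t₀) < ε

end MSP

open MSP

namespace MSP

variable {d : ℕ}

section Wasserstein

lemma coe_nnnorm_sub (x y : Rd d) : (‖x - y‖₊ : ℝ≥0∞) = ENNReal.ofReal (dist x y) := by
  rw [dist_eq_norm, ofReal_norm]; rfl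

lemma sq_nnnorm_sub_le (x y : Rd d) :
    (‖x - y‖₊ : ℝ≥0∞) ^ 2 ≤ 2 * (‖x‖₊ : ℝ≥0∞) ^ 2 + 2 * (‖y‖₊ : ℝ≥0∞) ^ 2 := by
  have h : ‖x - y‖₊ ^ 2 ≤ 2 * ‖x‖₊ ^ 2 + 2 * ‖y‖₊ ^ 2 := by
    rw [← NNReal.coe_le_coe]
    push_cast
    nlinarith [norm_sub_le x y, norm_nonneg (x - y), sq_nonneg (‖x‖ - ‖y‖)]
  exact_mod_cast h

lemma W2sq_le_cost2 {π : Measure (Rd d × Rd d)} {μ ν : Measure (Rd d)}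
    (h : IsCoupling π μ ν) : W2sq μ ν ≤ cost2 π :=
  sInf_le ⟨π, h, rfl⟩

lemma IsCoupling.swap {π : Measure (Rd d × Rd d)} {μ ν : Measure (Rd d)}
    (h : IsCoupling π μ ν) : IsCoupling (π.map Prod.swap) ν μ := by
  refine ⟨?_, ?_⟩
  · rw [Measure.map_map measurable_fst measurable_swap]; exact h.2
  · rw [Measure.map_map measurable_snd measurable_swap]; exact h.1

lemma cost2_swap (π : Measure (Rd d × Rd d)) : cost2 (π.map Prod.swap) = cost2 π := by
  unfold cost2
  rw [lintegral_map (by fun_prop) measurable_swap]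
  refine lintegral_congr fun p => ?_
  rw [coe_nnnorm_sub, coe_nnnorm_sub, dist_comm]
  rfl

lemma W2sq_comm (μ ν : Measure (Rd d)) : W2sq μ ν = W2sq ν μ := by
  have key : ∀ μ ν : Measure (Rd d), W2sq μ ν ≤ W2sq ν μ := by
    intro μ ν
    refine le_sInf ?_
    rintro _ ⟨π, hπ, rfl⟩
    rw [← cost2_swap]
    exact W2sq_le_cost2 hπ.swap
  exact le_antisymm (key _ _) (key _ _)

lemma W2sq_lt_top {μ ν : Measure (Rd d)} (hμ : IsP2 μ) (hν : IsP2 ν) : W2sq μ ν < ⊤ := by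
  have := hμ.1
  have := hν.1
  have hc : IsCoupling (μ.prod ν) μ ν := ⟨by simp, by simp⟩
  refine (W2sq_le_cost2 hc).trans_lt ?_
  have h1 : ∫⁻ p, (‖p.1‖₊ : ℝ≥0∞) ^ 2 ∂(μ.prod ν) = ∫⁻ x, (‖x‖₊ : ℝ≥0∞) ^ 2 ∂μ := by
    conv_rhs => rw [← hc.1]
    rw [lintegral_map (by fun_prop) measurable_fst]
  have h2 : ∫⁻ p, (‖p.2‖₊ : ℝ≥0∞) ^ 2 ∂(μ.prod ν) = ∫⁻ x, (‖x‖₊ : ℝ≥0∞) ^ 2 ∂ν := by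
    conv_rhs => rw [← hc.2]
    rw [lintegral_map (by fun_prop) measurable_snd]
  calc cost2 (μ.prod ν)
      ≤ ∫⁻ p, (2 * (‖p.1‖₊ : ℝ≥0∞) ^ 2 + 2 * (‖p.2‖₊ : ℝ≥0∞) ^ 2) ∂(μ.prod ν) :=
        lintegral_mono fun p => sq_nnnorm_sub_le p.1 p.2
    _ = 2 * ∫⁻ x, (‖x‖₊ : ℝ≥0∞) ^ 2 ∂μ + 2 * ∫⁻ x, (‖x‖₊ : ℝ≥0∞) ^ 2 ∂ν := by
        rw [lintegral_add_left (by fun_prop), lintegral_const_mul _ (by fun_prop),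
          lintegral_const_mul _ (by fun_prop), h1, h2]
    _ < ⊤ := ENNReal.add_lt_top.2
        ⟨ENNReal.mul_lt_top (by simp) hμ.2, ENNReal.mul_lt_top (by simp) hν.2⟩

lemma W2sq_eq_ofReal {μ ν : Measure (Rd d)} (hμ : IsP2 μ) (hν : IsP2 ν) :
    W2sq μ ν = ENNReal.ofReal (W2 μ ν ^ 2) := by
  rw [W2, Real.sq_sqrt ENNReal.toReal_nonneg, ENNReal.ofReal_toReal (W2sq_lt_top hμ hν).ne]

end Wasserstein

section DistSq

/-- The integral of the squared distance to `C`. -/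
def distSq (C : Set (Rd d)) (μ : Measure (Rd d)) : ℝ≥0∞ :=
  ∫⁻ x, ENNReal.ofReal (infDist x C) ^ 2 ∂μ

lemma measurable_ofReal_infDist (C : Set (Rd d)) :
    Measurable fun x : Rd d => ENNReal.ofReal (infDist x C) :=
  ENNReal.measurable_ofReal.comp (continuous_infDist_pt C).measurable

lemma IsCoupling.lintegral_fst {π : Measure (Rd d × Rd d)} {μ ν : Measure (Rd d)}
    (h : IsCoupling π μ ν) {f : Rd d → ℝ≥0∞} (hf : Measurable f) :
    ∫⁻ p, f p.1 ∂π = ∫⁻ x, f x ∂μ := by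
  rw [← h.1, lintegral_map hf measurable_fst]

lemma IsCoupling.lintegral_snd {π : Measure (Rd d × Rd d)} {μ ν : Measure (Rd d)}
    (h : IsCoupling π μ ν) {f : Rd d → ℝ≥0∞} (hf : Measurable f) :
    ∫⁻ p, f p.2 ∂π = ∫⁻ x, f x ∂ν := by
  rw [← h.2, lintegral_map hf measurable_snd]

lemma sqrt_distSq_le_cost2 (C : Set (Rd d)) {π : Measure (Rd d × Rd d)} {μ ν : Measure (Rd d)}
    (h : IsCoupling π μ ν) :
    distSq C μ ^ (1 / 2 : ℝ) ≤ cost2 π ^ (1 / 2 : ℝ) + distSq C ν ^ (1 / 2 : ℝ) := by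
  have hm := measurable_ofReal_infDist C
  have hL := ENNReal.lintegral_Lp_add_le (μ := π) (p := 2)
    (f := fun p => (‖p.1 - p.2‖₊ : ℝ≥0∞)) (g := fun p => ENNReal.ofReal (infDist p.2 C))
    (by fun_prop) (hm.comp measurable_snd).aemeasurable (by norm_num)
  simp only [ENNReal.rpow_two] at hL
  rw [h.lintegral_snd (hm.pow_const 2)] at hL
  refine le_trans (ENNReal.rpow_le_rpow ?_ (by norm_num)) hL
  rw [distSq, ← h.lintegral_fst (hm.pow_const 2)]
  refine lintegral_mono fun p => pow_le_pow_left' ?_ 2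
  simp only [Pi.add_apply, coe_nnnorm_sub]
  rw [← ENNReal.ofReal_add dist_nonneg infDist_nonneg, add_comm]
  exact ENNReal.ofReal_le_ofReal infDist_le_infDist_add_dist

lemma sqrt_distSq_le (C : Set (Rd d)) (μ ν : Measure (Rd d)) :
    distSq C μ ^ (1 / 2 : ℝ) ≤ W2sq μ ν ^ (1 / 2 : ℝ) + distSq C ν ^ (1 / 2 : ℝ) := by
  rw [← tsub_le_iff_right, one_div, ENNReal.le_rpow_inv_iff (by norm_num)]
  refine le_sInf ?_
  rintro _ ⟨π, hπ, rfl⟩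
  rw [← ENNReal.le_rpow_inv_iff (by norm_num), tsub_le_iff_right, ← one_div]
  exact sqrt_distSq_le_cost2 C hπ

lemma sqrt_ofReal_sq_mul {a : ℝ} (ha : 0 ≤ a) (N : ℝ≥0∞) :
    (ENNReal.ofReal (a ^ 2) * N) ^ (1 / 2 : ℝ) = ENNReal.ofReal a * N ^ (1 / 2 : ℝ) := by
  rw [ENNReal.mul_rpow_of_nonneg _ _ (by norm_num), ENNReal.ofReal_rpow_of_nonneg (by positivity)
    (by norm_num), ← Real.sqrt_eq_rpow, Real.sqrt_sq ha]

end DistSq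

section Interpolation

/-- The linear interpolation between the identity and `P`. -/
def interp (P : Rd d → Rd d) (t : ℝ) (x : Rd d) : Rd d := (1 - t) • x + t • P x

lemma aemeasurable_interp {θ : Measure (Rd d)} {P : Rd d → Rd d} (hPm : AEMeasurable P θ)
    (t : ℝ) : AEMeasurable (interp P t) θ :=
  (aemeasurable_id.const_smul (1 - t)).add (hPm.const_smul t)

lemma dist_interp (P : Rd d → Rd d) (s t : ℝ) (x : Rd d) :
    dist (interp P s x) (interp P t x) = |s - t| * dist x (P x) := by
  have : interp P s x - interp P t x = (t - s) • (x - P x) := by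
    unfold interp; module
  rw [dist_eq_norm, this, norm_smul, Real.norm_eq_abs, abs_sub_comm, dist_eq_norm]

lemma infDist_interp {C : Set (Rd d)} {P : Rd d → Rd d} {x : Rd d} (hC : P x ∈ C)
    (hx : dist x (P x) = infDist x C) {t : ℝ} (ht : t ∈ Icc (0 : ℝ) 1) :
    infDist (interp P t x) C = (1 - t) * infDist x C := by
  have h0 : dist x (interp P t x) = t * infDist x C := by
    have := dist_interp P 0 t x
    rwa [show interp P 0 x = x by simp [interp], zero_sub, abs_neg, abs_of_nonneg ht.1, hx] at this
  have h1 : dist (interp P t x) (P x) = (1 - t) * infDist x C := by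
    have := dist_interp P t 1 x
    rwa [show interp P 1 x = P x by simp [interp], abs_sub_comm, abs_of_nonneg (by linarith [ht.2]),
      hx] at this
  refine le_antisymm (h1 ▸ infDist_le_dist_of_mem hC) ?_
  have := infDist_le_infDist_add_dist (s := C) (x := x) (y := interp P t x)
  linarith

variable {C : Set (Rd d)} {θ : Measure (Rd d)} {P : Rd d → Rd d}

lemma distSq_map_interp (hPm : AEMeasurable P θ)
    (hP : ∀ᵐ x ∂θ, P x ∈ C ∧ dist x (P x) = infDist x C) {t : ℝ} (ht : t ∈ Icc (0 : ℝ) 1) :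
    distSq C (θ.map (interp P t)) = ENNReal.ofReal ((1 - t) ^ 2) * distSq C θ := by
  have hm := (measurable_ofReal_infDist C).pow_const 2
  rw [distSq, lintegral_map' hm.aemeasurable (aemeasurable_interp hPm t), distSq,
    ← lintegral_const_mul _ hm]
  refine lintegral_congr_ae ?_
  filter_upwards [hP] with x hx
  have h1 : 0 ≤ 1 - t := by linarith [ht.2]
  rw [infDist_interp hx.1 hx.2 ht, ENNReal.ofReal_mul h1, mul_pow, ENNReal.ofReal_pow h1]

lemma W2sq_map_interp_le (hPm : AEMeasurable P θ)
    (hP : ∀ᵐ x ∂θ, P x ∈ C ∧ dist x (P x) = infDist x C) (s t : ℝ) :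
    W2sq (θ.map (interp P s)) (θ.map (interp P t)) ≤
      ENNReal.ofReal ((s - t) ^ 2) * distSq C θ := by
  have hs := aemeasurable_interp hPm s
  have ht := aemeasurable_interp hPm t
  have hc : IsCoupling (θ.map fun x => (interp P s x, interp P t x))
      (θ.map (interp P s)) (θ.map (interp P t)) := by
    refine ⟨?_, ?_⟩
    · rw [AEMeasurable.map_map_of_aemeasurable measurable_fst.aemeasurable (hs.prodMk ht)]; rfl
    · rw [AEMeasurable.map_map_of_aemeasurable measurable_snd.aemeasurable (hs.prodMk ht)]; rfl
  refine (W2sq_le_cost2 hc).trans_eq ?_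
  have hm := (measurable_ofReal_infDist C).pow_const 2
  rw [cost2, lintegral_map' (by fun_prop) (hs.prodMk ht), distSq, ← lintegral_const_mul _ hm]
  refine lintegral_congr_ae ?_
  filter_upwards [hP] with x hx
  rw [coe_nnnorm_sub, dist_interp, hx.2, ENNReal.ofReal_mul (abs_nonneg _), mul_pow,
    ← ENNReal.ofReal_pow (abs_nonneg _), sq_abs]

lemma isP2_map_interp (hC : Bornology.IsBounded C) (hθ : IsP2 θ) (hPm : AEMeasurable P θ)
    (hP : ∀ᵐ x ∂θ, P x ∈ C) {t : ℝ} (ht : t ∈ Icc (0 : ℝ) 1) :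
    IsP2 (θ.map (interp P t)) := by
  have := hθ.1
  have hm := aemeasurable_interp hPm t
  refine ⟨Measure.isProbabilityMeasure_map hm, ?_⟩
  obtain ⟨M, hM⟩ := hC.exists_norm_le
  rw [HasFiniteSecondMoment, lintegral_map' (by fun_prop) hm]
  calc ∫⁻ x, (‖interp P t x‖₊ : ℝ≥0∞) ^ 2 ∂θ
      ≤ ∫⁻ x, (2 * (‖x‖₊ : ℝ≥0∞) ^ 2 + 2 * (M.toNNReal : ℝ≥0∞) ^ 2) ∂θ := by
        refine lintegral_mono_ae ?_
        filter_upwards [hP] with x hx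
        have hPM := hM _ hx
        have hM0 : 0 ≤ M := (norm_nonneg _).trans hPM
        have h : ‖interp P t x‖₊ ^ 2 ≤ 2 * ‖x‖₊ ^ 2 + 2 * M.toNNReal ^ 2 := by
          rw [← NNReal.coe_le_coe]
          push_cast
          rw [Real.coe_toNNReal M hM0]
          have h1 : ‖interp P t x‖ ≤ ‖x‖ + M := by
            refine (norm_add_le _ _).trans (add_le_add ?_ ?_)
            · rw [norm_smul, Real.norm_of_nonneg (by linarith [ht.2])]
              exact mul_le_of_le_one_left (norm_nonneg _) (by linarith [ht.1])
            · rw [norm_smul, Real.norm_of_nonneg ht.1]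
              exact (mul_le_of_le_one_left (norm_nonneg _) ht.2).trans hPM
          nlinarith [norm_nonneg (interp P t x), sq_nonneg (‖x‖ - M)]
        exact_mod_cast h
    _ = 2 * ∫⁻ x, (‖x‖₊ : ℝ≥0∞) ^ 2 ∂θ + 2 * (M.toNNReal : ℝ≥0∞) ^ 2 := by
        rw [lintegral_add_left (by fun_prop), lintegral_const_mul _ (by fun_prop)]
        simp
    _ < ⊤ := ENNReal.add_lt_top.2 ⟨ENNReal.mul_lt_top (by simp) hθ.2, by finiteness⟩

lemma W2sq_map_interp (hPm : AEMeasurable P θ)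
    (hP : ∀ᵐ x ∂θ, P x ∈ C ∧ dist x (P x) = infDist x C) (hfin : distSq C θ ≠ ⊤)
    {s t : ℝ} (hs : s ∈ Icc (0 : ℝ) 1) (ht : t ∈ Icc (0 : ℝ) 1) :
    W2sq (θ.map (interp P s)) (θ.map (interp P t)) =
      ENNReal.ofReal ((s - t) ^ 2) * distSq C θ := by
  wlog hst : s ≤ t generalizing s t
  · rw [W2sq_comm, this ht hs (le_of_not_ge hst), ← neg_sub, neg_sq]
  refine le_antisymm (W2sq_map_interp_le hPm hP s t) ?_
  have h := sqrt_distSq_le C (θ.map (interp P s)) (θ.map (interp P t))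
  have hn : distSq C θ ^ (1 / 2 : ℝ) ≠ ⊤ := ENNReal.rpow_ne_top_of_nonneg (by norm_num) hfin
  have ht1 : 0 ≤ 1 - t := by linarith [ht.2]
  rw [distSq_map_interp hPm hP hs, distSq_map_interp hPm hP ht,
    sqrt_ofReal_sq_mul (by linarith), sqrt_ofReal_sq_mul ht1,
    show 1 - s = (t - s) + (1 - t) by ring, ENNReal.ofReal_add (by linarith) ht1, add_mul,
    ENNReal.add_le_add_iff_right (by finiteness), ← sqrt_ofReal_sq_mul (by linarith),
    ENNReal.rpow_le_rpow_iff (by norm_num)] at h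
  rwa [← neg_sub, neg_sq]

end Interpolation

section Uniqueness

lemma sq_infDist_le (C : Set (Rd d)) {t : ℝ} (ht : t ∈ Ioo (0 : ℝ) 1) (x z : Rd d) :
    infDist x C ^ 2 ≤ dist x z ^ 2 / t + infDist z C ^ 2 / (1 - t) := by
  have h0 := ht.1
  have h1 : 0 < 1 - t := by linarith [ht.2]
  have h := infDist_le_infDist_add_dist (s := C) (x := x) (y := z)
  have hx : 0 ≤ infDist x C := infDist_nonneg
  rw [div_add_div _ _ h0.ne' h1.ne', le_div_iff₀ (by positivity)]
  have : infDist x C ^ 2 ≤ (infDist z C + dist x z) ^ 2 := by gcongr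
  have := mul_le_mul_of_nonneg_right this (mul_pos h0 h1).le
  nlinarith [sq_nonneg (dist x z * (1 - t) - infDist z C * t)]

lemma eq_interp_of_le {C : Set (Rd d)} (hC : IsCompact C) (hne : C.Nonempty)
    {P : Rd d → Rd d} {x z : Rd d} (hP : projSet C x = {P x}) {t : ℝ} (ht : t ∈ Ioo (0 : ℝ) 1)
    (hF : dist x z ^ 2 / t + infDist z C ^ 2 / (1 - t) ≤ infDist x C ^ 2) :
    z = interp P t x := by
  obtain ⟨w, hwC, hw⟩ := hC.exists_infDist_eq_dist hne z
  have h0 := ht.1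
  have h1 : 0 < 1 - t := by linarith [ht.2]
  have htri := dist_triangle x z w
  have hxw := infDist_le_dist_of_mem (x := x) hwC
  have hx : 0 ≤ infDist x C := infDist_nonneg
  rw [hw, div_add_div _ _ h0.ne' h1.ne', div_le_iff₀ (by positivity)] at hF
  have hle : infDist x C ^ 2 ≤ (dist x z + dist z w) ^ 2 := by
    gcongr; linarith
  have hle' := mul_le_mul_of_nonneg_right hle (mul_pos h0 h1).le
  have hprop : dist x z * (1 - t) = dist z w * t := by
    have : (dist x z * (1 - t) - dist z w * t) ^ 2 = 0 :=
      le_antisymm (by nlinarith) (sq_nonneg _)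
    linarith [pow_eq_zero_iff (two_ne_zero) |>.1 this]
  have hge : dist x z + dist z w ≤ infDist x C := by
    refine le_of_sq_le_sq ?_ hx
    refine le_of_mul_le_mul_right ?_ (mul_pos h0 h1)
    nlinarith
  have hxw' : dist x w = infDist x C := le_antisymm (htri.trans hge) hxw
  have hwP : w = P x := by
    have : w ∈ projSet C x := ⟨hwC, hxw'⟩
    rwa [hP] at this
  have hsum : dist x z + dist z w = dist x w := le_antisymm (hge.trans hxw) htri
  have h := eq_lineMap_of_dist_eq_mul_of_dist_eq_mul (r := t) (x := x) (y := z) (z := w)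
    (by rw [← hsum]; linarith) (by rw [← hsum]; linarith)
  rw [h, hwP, AffineMap.lineMap_apply_module, interp]

lemma exists_gap {C : Set (Rd d)} (hC : IsCompact C) (hne : C.Nonempty)
    {P : Rd d → Rd d} {L B : Set (Rd d)} (hL : IsCompact L) (hB : IsOpen B)
    {t : ℝ} (ht : t ∈ Ioo (0 : ℝ) 1)
    (hP : ∀ x ∈ L, projSet C x = {P x}) (hLB : ∀ x ∈ L, interp P t x ∈ B) :
    ∃ c : ℝ, 0 < c ∧ ∀ x ∈ L, ∀ z ∉ B,
      infDist x C ^ 2 + c ≤ dist x z ^ 2 / t + infDist z C ^ 2 / (1 - t) := by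
  set F : Rd d × Rd d → ℝ := fun p =>
    dist p.1 p.2 ^ 2 / t + infDist p.2 C ^ 2 / (1 - t) - infDist p.1 C ^ 2 with hFdef
  have h0 := ht.1
  have h1 : 0 < 1 - t := by linarith [ht.2]
  have hinf := continuous_infDist_pt C
  have hF : Continuous F := by
    have e1 : Continuous fun p : Rd d × Rd d => infDist p.1 C := hinf.comp continuous_fst
    have e2 : Continuous fun p : Rd d × Rd d => infDist p.2 C := hinf.comp continuous_snd
    fun_prop
  obtain ⟨M, hM⟩ := hL.exists_bound_of_continuousOn hinf.continuousOn
  obtain ⟨R, hR⟩ := hL.isBounded.exists_norm_le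
  set S : Set (Rd d × Rd d) := {p | p.1 ∈ L ∧ p.2 ∉ B ∧ F p ≤ 1}
  have hScl : IsClosed S :=
    (hL.isClosed.preimage continuous_fst).inter
      ((hB.isClosed_compl.preimage continuous_snd).inter (isClosed_le hF continuous_const))
  have hSc : IsCompact S := by
    refine (hL.prod (isCompact_closedBall (0 : Rd d) (R + (1 + (1 + M ^ 2))))).of_isClosed_subset
      hScl ?_
    rintro ⟨x, z⟩ ⟨hx, -, hFx⟩
    refine ⟨hx, ?_⟩
    simp only [hFdef] at hFx hx
    have hMx := hM x hx
    rw [Real.norm_of_nonneg infDist_nonneg] at hMx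
    have hd2 : infDist x C ^ 2 ≤ M ^ 2 := by
      have : 0 ≤ infDist x C := infDist_nonneg
      gcongr
    have hz : 0 ≤ infDist z C ^ 2 / (1 - t) := by positivity
    have hdt : dist x z ^ 2 ≤ dist x z ^ 2 / t := le_div_self (sq_nonneg _) h0 ht.2.le
    have hdist : dist x z ≤ 1 + (1 + M ^ 2) := by
      nlinarith [sq_nonneg (dist x z - 1)]
    rw [mem_closedBall, dist_zero_right]
    have := norm_le_norm_add_norm_sub' z x
    rw [← dist_eq_norm, dist_comm] at this
    linarith [hR x hx]
  have hpos : ∀ p : Rd d × Rd d, p.1 ∈ L → p.2 ∉ B → 0 < F p := by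
    intro p hp1 hp2
    by_contra hcon
    refine hp2 ?_
    have hz : p.2 = interp P t p.1 :=
      eq_interp_of_le hC hne (hP _ hp1) ht (by simp only [hFdef] at hcon; linarith)
    exact hz ▸ hLB _ hp1
  obtain ⟨c, hc, hc1, hcS⟩ : ∃ c : ℝ, 0 < c ∧ c ≤ 1 ∧ ∀ p ∈ S, c ≤ F p := by
    rcases S.eq_empty_or_nonempty with hemp | hnon
    · exact ⟨1, one_pos, le_rfl, by simp [hemp]⟩
    · obtain ⟨p, hp, hmin⟩ := hSc.exists_isMinOn hnon hF.continuousOn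
      exact ⟨F p, hpos p hp.1 hp.2.1, hp.2.2, fun q hq => hmin hq⟩
  refine ⟨c, hc, fun x hx z hz => ?_⟩
  have : c ≤ F (x, z) := by
    by_cases hle : F (x, z) ≤ 1
    · exact hcS _ ⟨hx, hz, hle⟩
    · linarith
  simp only [hFdef] at this
  linarith

lemma IsCoupling.gap_mul_measure_le {C : Set (Rd d)} {L B : Set (Rd d)} (hL : MeasurableSet L)
    (hB : MeasurableSet B) {t c : ℝ} (ht : t ∈ Ioo (0 : ℝ) 1) (hc : 0 < c)
    (hgap : ∀ x ∈ L, ∀ z ∉ B,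
      infDist x C ^ 2 + c ≤ dist x z ^ 2 / t + infDist z C ^ 2 / (1 - t))
    {π : Measure (Rd d × Rd d)} {μ ν : Measure (Rd d)} (h : IsCoupling π μ ν) :
    distSq C μ + ENNReal.ofReal c * π (L ×ˢ Bᶜ) ≤
      ENNReal.ofReal t⁻¹ * cost2 π + ENNReal.ofReal (1 - t)⁻¹ * distSq C ν := by
  have h0 := ht.1
  have h1 : 0 < 1 - t := by linarith [ht.2]
  have hm := (measurable_ofReal_infDist C).pow_const 2
  have hm1 : Measurable fun p : Rd d × Rd d => ENNReal.ofReal (infDist p.1 C) ^ 2 :=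
    hm.comp measurable_fst
  have hm2 : Measurable fun p : Rd d × Rd d => ENNReal.ofReal (infDist p.2 C) ^ 2 :=
    hm.comp measurable_snd
  have hLB : MeasurableSet (L ×ˢ Bᶜ) := hL.prod hB.compl
  rw [distSq, distSq, cost2, ← h.lintegral_fst hm, ← h.lintegral_snd hm,
    ← lintegral_const_mul _ (by fun_prop), ← lintegral_const_mul _ hm2,
    ← lintegral_add_left (by fun_prop), ← lintegral_indicator_const hLB,
    ← lintegral_add_left hm1]
  refine lintegral_mono fun p => ?_
  have hR : ENNReal.ofReal t⁻¹ * (‖p.1 - p.2‖₊ : ℝ≥0∞) ^ 2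
      + ENNReal.ofReal (1 - t)⁻¹ * ENNReal.ofReal (infDist p.2 C) ^ 2 =
      ENNReal.ofReal (dist p.1 p.2 ^ 2 / t + infDist p.2 C ^ 2 / (1 - t)) := by
    rw [coe_nnnorm_sub, ← ENNReal.ofReal_pow dist_nonneg, ← ENNReal.ofReal_pow infDist_nonneg,
      ← ENNReal.ofReal_mul (by positivity), ← ENNReal.ofReal_mul (by positivity),
      ← ENNReal.ofReal_add (by positivity) (by positivity), inv_mul_eq_div, inv_mul_eq_div]
  rw [hR, ← ENNReal.ofReal_pow infDist_nonneg]
  by_cases hp : p ∈ L ×ˢ Bᶜ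
  · rw [indicator_of_mem hp, ← ENNReal.ofReal_add (by positivity) hc.le]
    exact ENNReal.ofReal_le_ofReal (hgap _ hp.1 _ hp.2)
  · rw [indicator_of_notMem hp, add_zero]
    exact ENNReal.ofReal_le_ofReal (sq_infDist_le C ht _ _)

lemma measure_le_of_gap {C : Set (Rd d)} {L B : Set (Rd d)} (hL : MeasurableSet L)
    (hB : MeasurableSet B) {t c : ℝ} (ht : t ∈ Ioo (0 : ℝ) 1) (hc : 0 < c)
    (hgap : ∀ x ∈ L, ∀ z ∉ B,
      infDist x C ^ 2 + c ≤ dist x z ^ 2 / t + infDist z C ^ 2 / (1 - t))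
    {μ ν : Measure (Rd d)} (hfin : distSq C μ ≠ ⊤)
    (hW : W2sq μ ν = ENNReal.ofReal (t ^ 2) * distSq C μ)
    (hν : distSq C ν ≤ ENNReal.ofReal ((1 - t) ^ 2) * distSq C μ) :
    μ L ≤ ν B := by
  have h0 := ht.1
  have h1 : 0 < 1 - t := by linarith [ht.2]
  refine ENNReal.le_of_forall_pos_le_add fun ε hε _ => ?_
  have hη : 0 < t * c * ε := by positivity
  have hlt : W2sq μ ν < W2sq μ ν + ENNReal.ofReal (t * c * ε) :=
    ENNReal.lt_add_right (by rw [hW]; finiteness) (by simpa using hη)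
  obtain ⟨_, ⟨π, hπ, rfl⟩, hlt⟩ := sInf_lt_iff.1 (show sInf _ < _ from hlt)
  have hkey := hπ.gap_mul_measure_le hL hB ht hc hgap
  have hπle : π (L ×ˢ Bᶜ) ≤ ε := by
    have hbound : distSq C μ + ENNReal.ofReal c * π (L ×ˢ Bᶜ) ≤
        distSq C μ + ENNReal.ofReal c * ε := by
      refine hkey.trans ?_
      calc _ ≤ ENNReal.ofReal t⁻¹ * (ENNReal.ofReal (t ^ 2) * distSq C μ
              + ENNReal.ofReal (t * c * ε))
            + ENNReal.ofReal (1 - t)⁻¹ * (ENNReal.ofReal ((1 - t) ^ 2) * distSq C μ) := by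
            gcongr
            rw [← hW]; exact hlt.le
        _ = (ENNReal.ofReal t + ENNReal.ofReal (1 - t)) * distSq C μ
            + ENNReal.ofReal (c * ε) := by
            have e1 : ENNReal.ofReal t⁻¹ * ENNReal.ofReal (t ^ 2) = ENNReal.ofReal t := by
              rw [← ENNReal.ofReal_mul (by positivity)]; congr 1; field_simp
            have e2 : ENNReal.ofReal (1 - t)⁻¹ * ENNReal.ofReal ((1 - t) ^ 2)
                = ENNReal.ofReal (1 - t) := by
              rw [← ENNReal.ofReal_mul (by positivity)]; congr 1; field_simp
            have e3 : ENNReal.ofReal t⁻¹ * ENNReal.ofReal (t * c * ε)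
                = ENNReal.ofReal (c * ε) := by
              rw [← ENNReal.ofReal_mul (by positivity)]; congr 1; field_simp
            rw [mul_add, ← mul_assoc, ← mul_assoc, e1, e2, e3]
            ring
        _ = distSq C μ + ENNReal.ofReal c * ε := by
            rw [← ENNReal.ofReal_add h0.le h1.le, add_sub_cancel, ENNReal.ofReal_one, one_mul,
              ENNReal.ofReal_mul hc.le, ENNReal.ofReal_coe_nnreal]
    rw [ENNReal.add_le_add_iff_left hfin] at hbound
    exact (ENNReal.mul_le_mul_iff_right (by simpa using hc) (by finiteness)).1 hbound
  calc μ L = π (Prod.fst ⁻¹' L) := by rw [← hπ.1, Measure.map_apply measurable_fst hL]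
    _ ≤ π (Prod.snd ⁻¹' B ∪ L ×ˢ Bᶜ) := by
        refine measure_mono fun p hp => ?_
        by_cases hpB : p.2 ∈ B
        · exact Or.inl hpB
        · exact Or.inr ⟨hp, hpB⟩
    _ ≤ π (Prod.snd ⁻¹' B) + π (L ×ˢ Bᶜ) := measure_union_le _ _
    _ ≤ ν B + ε := by
        rw [← Measure.map_apply measurable_snd hB, hπ.2]
        gcongr

lemma eq_of_forall_isOpen_le {μ ν : Measure (Rd d)} [IsProbabilityMeasure μ]
    [IsProbabilityMeasure ν] (h : ∀ B, IsOpen B → μ B ≤ ν B) : μ = ν := by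
  refine Measure.eq_of_le_of_measure_univ_eq (Measure.le_iff.2 fun A _ => ?_) (by simp)
  refine le_of_forall_gt fun a ha => ?_
  obtain ⟨B, hAB, hB, hBa⟩ := A.exists_isOpen_lt_of_lt a ha
  exact ((measure_mono hAB).trans (h B hB)).trans_lt hBa

lemma eq_map_interp {C U : Set (Rd d)} (hC : IsCompact C) (hne : C.Nonempty)
    {P : Rd d → Rd d} (hU : IsOpen U) (hP : ∀ x ∈ U, projSet C x = {P x})
    (hPc : ContinuousOn P U) {θ ν : Measure (Rd d)} [IsProbabilityMeasure θ]
    [IsProbabilityMeasure ν] (hPm : AEMeasurable P θ) (hθU : ∀ᵐ x ∂θ, x ∈ U)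
    {t : ℝ} (ht : t ∈ Ioo (0 : ℝ) 1) (hfin : distSq C θ ≠ ⊤)
    (hW : W2sq θ ν = ENNReal.ofReal (t ^ 2) * distSq C θ)
    (hν : distSq C ν ≤ ENNReal.ofReal ((1 - t) ^ 2) * distSq C θ) :
    ν = θ.map (interp P t) := by
  have hm := aemeasurable_interp hPm t
  have := Measure.isProbabilityMeasure_map hm
  refine (eq_of_forall_isOpen_le fun B hB => ?_).symm
  have hcont : ContinuousOn (interp P t) U :=
    (continuousOn_id.const_smul (1 - t)).add (hPc.const_smul t)
  have hopen := hcont.isOpen_inter_preimage hU hB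
  have heq : θ (interp P t ⁻¹' B) = θ (U ∩ interp P t ⁻¹' B) := by
    refine measure_congr ?_
    filter_upwards [hθU] with x hx
    exact propext ⟨fun h => ⟨hx, h⟩, fun h => h.2⟩
  rw [Measure.map_apply_of_aemeasurable hm hB.measurableSet, heq]
  refine le_of_forall_lt fun a ha => ?_
  obtain ⟨L, hLU, hL, haL⟩ := hopen.exists_lt_isCompact ha
  obtain ⟨c, hc, hgap⟩ := exists_gap hC hne hL hB ht (fun x hx => hP x (hLU hx).1)
    (fun x hx => (hLU hx).2)
  exact haL.trans_le (measure_le_of_gap hL.measurableSet hB.measurableSet ht hc hgap hfin hW hν)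

end Uniqueness

lemma ae_mem_msupport (μ : Measure (Rd d)) : ∀ᵐ x ∂μ, x ∈ msupport μ := by
  refine measure_null_of_locally_null _ fun x hx => ?_
  have hx' : ∃ U : Set (Rd d), IsOpen U ∧ x ∈ U ∧ μ U = 0 := by
    simpa [msupport] using hx
  obtain ⟨U, hU, hxU, h0⟩ := hx'
  exact ⟨U, mem_nhdsWithin_of_mem_nhds (hU.mem_nhds hxU), h0⟩

end MSP

/-- Lemma (the unique geodesic between a measure and its projection on a
prox-regular set is the linear interpolation along the projection map). -/
theorem stmt6 {d : ℕ} (r : ℝ) (hr : 0 < r) (C : Set (Rd d))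
    (hCb : Bornology.IsBounded C) (hC : IsProxRegular r C)
    (θ : Measure (Rd d)) (hθ : IsP2 θ)
    (hθsupp : msupport θ ⊆ Metric.thickening r C)
    (P : Rd d → Rd d)
    (hP : ∀ x, infDist x C < r → projSet C x = {P x})
    (hPc : ContinuousOn P {x | infDist x C < r})
    (ρ : ℝ → Measure (Rd d))
    (hρ : ρ = fun t : ℝ => θ.map (fun x => (1 - t) • x + t • P x)) :
    (∀ t ∈ Icc (0:ℝ) 1, IsP2 (ρ t)) ∧
    ρ 0 = θ ∧ ρ 1 = θ.map P ∧
    (∀ s ∈ Icc (0:ℝ) 1, ∀ t ∈ Icc (0:ℝ) 1,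
      W2 (ρ s) (ρ t) = |s - t| * W2 θ (θ.map P)) ∧
    ∀ σ : ℝ → Measure (Rd d), (∀ t ∈ Icc (0:ℝ) 1, IsP2 (σ t)) →
      σ 0 = θ → σ 1 = θ.map P →
      (∀ s ∈ Icc (0:ℝ) 1, ∀ t ∈ Icc (0:ℝ) 1,
        W2 (σ s) (σ t) = |s - t| * W2 θ (θ.map P)) →
      ∀ t ∈ Icc (0:ℝ) 1, σ t = ρ t := by
  have := hθ.1
  have hne : C.Nonempty := by
    by_contra hcon
    rw [not_nonempty_iff_eq_empty] at hcon
    have h := hP 0 (by simpa [hcon] using hr)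
    have h0 : P 0 ∈ projSet C 0 := h ▸ mem_singleton _
    simpa [hcon] using h0.1
  have hCc : IsCompact C := Metric.isCompact_of_isClosed_isBounded hC.1 hCb
  set U : Set (Rd d) := {x | infDist x C < r} with hUdef
  have hU : IsOpen U := isOpen_lt (continuous_infDist_pt C) continuous_const
  have hθU : ∀ᵐ x ∂θ, x ∈ U := by
    filter_upwards [ae_mem_msupport θ] with x hx
    obtain ⟨y, hy, hxy⟩ := Metric.mem_thickening_iff.1 (hθsupp hx)
    exact (infDist_le_dist_of_mem hy).trans_lt hxy
  have hPm : AEMeasurable P θ := by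
    have h := hPc.aemeasurable (μ := θ) hU.measurableSet
    rwa [Measure.restrict_eq_self_of_ae_mem hθU] at h
  have hPC : ∀ᵐ x ∂θ, P x ∈ C ∧ dist x (P x) = infDist x C := by
    filter_upwards [hθU] with x hx
    have h : P x ∈ projSet C x := hP x hx ▸ mem_singleton _
    exact h
  have hρ' : ∀ t, ρ t = θ.map (interp P t) := fun t => by rw [hρ]; rfl
  have hρ0 : ρ 0 = θ := by simp [hρ]
  have hρ1 : ρ 1 = θ.map P := by simp [hρ]
  have hρP2 : ∀ t ∈ Icc (0 : ℝ) 1, IsP2 (ρ t) := fun t ht => by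
    rw [hρ']; exact isP2_map_interp hCb hθ hPm (hPC.mono fun x hx => hx.1) ht
  have hzero : distSq C (θ.map P) = 0 := by
    rw [← hρ1, hρ', distSq_map_interp hPm hPC (right_mem_Icc.2 zero_le_one)]
    simp
  have hθC : IsP2 (θ.map P) := hρ1 ▸ hρP2 1 (right_mem_Icc.2 zero_le_one)
  have hfin : distSq C θ ≠ ⊤ := by
    intro htop
    have h := sqrt_distSq_le C θ (θ.map P)
    rw [htop, hzero, ENNReal.top_rpow_of_pos (by norm_num),
      ENNReal.zero_rpow_of_pos (by norm_num), add_zero, top_le_iff] at h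
    exact ENNReal.rpow_ne_top_of_nonneg (by norm_num) (W2sq_lt_top hθ hθC).ne h
  have hWst : ∀ s ∈ Icc (0 : ℝ) 1, ∀ t ∈ Icc (0 : ℝ) 1,
      W2sq (ρ s) (ρ t) = ENNReal.ofReal ((s - t) ^ 2) * distSq C θ := fun s hs t ht => by
    rw [hρ', hρ', W2sq_map_interp hPm hPC hfin hs ht]
  have hW01 : W2sq θ (θ.map P) = distSq C θ := by
    have h := hWst 0 (left_mem_Icc.2 zero_le_one) 1 (right_mem_Icc.2 zero_le_one)
    rw [hρ0, hρ1] at h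
    simpa using h
  refine ⟨hρP2, hρ0, hρ1, fun s hs t ht => ?_, fun σ hσ hσ0 hσ1 hgeo t ht => ?_⟩
  · rw [W2, W2, hWst s hs t ht, hW01, ENNReal.toReal_mul, ENNReal.toReal_ofReal (sq_nonneg _),
      Real.sqrt_mul (sq_nonneg _), Real.sqrt_sq_eq_abs]
  · have hσW : ∀ s ∈ Icc (0 : ℝ) 1, ∀ t ∈ Icc (0 : ℝ) 1,
        W2sq (σ s) (σ t) = ENNReal.ofReal ((s - t) ^ 2) * distSq C θ := fun s hs t ht => by
      rw [W2sq_eq_ofReal (hσ s hs) (hσ t ht), hgeo s hs t ht, mul_pow, sq_abs,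
        ENNReal.ofReal_mul (sq_nonneg _), ← W2sq_eq_ofReal hθ hθC, hW01]
    rcases ht.1.eq_or_lt with rfl | h0
    · rw [hσ0, hρ0]
    rcases ht.2.eq_or_lt with rfl | h1
    · rw [hσ1, hρ1]
    have := (hσ t ht).1
    rw [hρ']
    refine eq_map_interp hCc hne hU hP hPc hPm hθU ⟨h0, h1⟩ hfin ?_ ?_
    · have h := hσW 0 (left_mem_Icc.2 zero_le_one) t ht
      rwa [hσ0, zero_sub, neg_sq] at h
    · have h := sqrt_distSq_le C (σ t) (σ 1)
      rw [hσW t ht 1 (right_mem_Icc.2 zero_le_one), hσ1, hzero,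
        ENNReal.zero_rpow_of_pos (by norm_num), add_zero,
        ENNReal.rpow_le_rpow_iff (by norm_num)] at h
      rwa [← neg_sub, neg_sq]
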